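/- Let y = v_j be a vertex and x ∈ [v_1, v_n] a point with y < x. Then sup_{s ∈ S} Γ^s(x, y) = sup { Γ^s(x, y) : s ∈ S and w_l^s = w_l^+ for every index l with v_l ≤ y }; in particular, if a worst case scenario for ⟨x, y⟩ (a maximizer of Γ^s(x, y) over S) exists, then one exists in which every vertex v_l with v_l ≤ y has weight w_l^+. -/

import Mathlib

open Finset
open scoped Classical

namespace DPN

noncomputable def score (τ c : ℝ) (v w : ℕ → ℝ) (h r j : ℕ) : ℝ :=
  τ * (v h - v j) + (∑ l ∈ Finset.Ioc r j, w l) / c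

noncomputable def nextHead (τ c : ℝ) (v w : ℕ → ℝ) (h r : ℕ) : ℕ :=
  (((Finset.Ioc r h).filter (fun j =>
      ∀ j' ∈ Finset.Ioc r h, score τ c v w h r j' ≤ score τ c v w h r j)).max).getD h

noncomputable def heads (τ c : ℝ) (v w : ℕ → ℝ) (h : ℕ) : ℕ → ℕ
  | 0 => 0
  | m + 1 => nextHead τ c v w h (heads τ c v w h m)

noncomputable def hIdx (n : ℕ) (v : ℕ → ℝ) (x : ℝ) : ℕ :=
  ((Finset.Icc 1 n).filter (fun i => v i < x)).card

noncomputable def phiL (n : ℕ) (τ c : ℝ) (v w : ℕ → ℝ) (x : ℝ) : ℝ :=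
  ∑ m ∈ Finset.range n,
    ((∑ l ∈ Finset.Ioc (heads τ c v w (hIdx n v x) m) (heads τ c v w (hIdx n v x) (m + 1)), w l) *
        (τ * (x - v (heads τ c v w (hIdx n v x) (m + 1)))) +
      (∑ l ∈ Finset.Ioc (heads τ c v w (hIdx n v x) m) (heads τ c v w (hIdx n v x) (m + 1)), w l) ^ 2 /
        (2 * c))

def rv (n : ℕ) (v : ℕ → ℝ) : ℕ → ℝ := fun l => -v (n + 1 - l)

def rw (n : ℕ) (w : ℕ → ℝ) : ℕ → ℝ := fun l => w (n + 1 - l)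

noncomputable def phiR (n : ℕ) (τ c : ℝ) (v w : ℕ → ℝ) (x : ℝ) : ℝ :=
  phiL n τ c (rv n v) (rw n w) (-x)

noncomputable def phi (n : ℕ) (τ c : ℝ) (v w : ℕ → ℝ) (x : ℝ) : ℝ :=
  phiL n τ c v w x + phiR n τ c v w x

/-- The set of scenarios: each vertex weight lies in its interval. -/
def scenarios (n : ℕ) (wm wp : ℕ → ℝ) : Set (ℕ → ℝ) :=
  {s | ∀ i, 1 ≤ i → i ≤ n → wm i ≤ s i ∧ s i ≤ wp i}

/-- The gap `Γ^s(x, y) = Φ^s(x) − Φ^s(y)`. -/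
noncomputable def gap (n : ℕ) (τ c : ℝ) (v s : ℕ → ℝ) (x y : ℝ) : ℝ :=
  phi n τ c v s x - phi n τ c v s y

/-- The regret `R^s(x) = Φ^s(x) − Φ^s(m^s)` (`Φ^s(m^s)` = min of `Φ^s` on `[v_1, v_n]`). -/
noncomputable def regret (n : ℕ) (τ c : ℝ) (v s : ℕ → ℝ) (x : ℝ) : ℝ :=
  phi n τ c v s x - sInf ((fun z => phi n τ c v s z) '' Set.Icc (v 1) (v n))

/-- The maximum regret `R_max(x) = sup_{s ∈ S} R^s(x)`. -/
noncomputable def maxRegret (n : ℕ) (τ c : ℝ) (v wm wp : ℕ → ℝ) (x : ℝ) : ℝ :=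
  sSup {r | ∃ s ∈ scenarios n wm wp, r = regret n τ c v s x}

/-- The left-pseudo-bipartite scenario `s(i, w)`. -/
def pseudoBipL (wm wp : ℕ → ℝ) (i : ℕ) (w : ℝ) : ℕ → ℝ :=
  fun l => if l < i then wp l else if l = i then w else wm l

/-- The right-pseudo-bipartite scenario `s(i, w)`. -/
def pseudoBipR (wm wp : ℕ → ℝ) (i : ℕ) (w : ℝ) : ℕ → ℝ :=
  fun l => if l < i then wm l else if l = i then w else wp l

/-- The head `ρ_m` of the left cluster containing vertex `i`: the smallest cluster head `≥ i`. -/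
noncomputable def clusterHeadOf (τ c : ℝ) (v w : ℕ → ℝ) (h i : ℕ) : ℕ :=
  ((((Finset.range (h + 1)).image (heads τ c v w h)).filter (fun r => i ≤ r)).min).getD h

/-- The head `ρ_{m−1}` preceding the left cluster containing vertex `i`:
the largest cluster head `< i`. -/
noncomputable def prevClusterHeadOf (τ c : ℝ) (v w : ℕ → ℝ) (h i : ℕ) : ℕ :=
  ((((Finset.range (h + 1)).image (heads τ c v w h)).filter (fun r => r < i)).max).getD 0

/-- The weight `σ_m` of the left cluster containing vertex `i`. -/
noncomputable def clusterWeightOf (τ c : ℝ) (v w : ℕ → ℝ) (h i : ℕ) : ℝ :=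
  ∑ l ∈ Finset.Ioc (prevClusterHeadOf τ c v w h i) (clusterHeadOf τ c v w h i), w l

/-- The sequence of right cluster heads for the vertex `y = v_j`
(expressed in the coordinates of the reflected network). -/
noncomputable def rightHeads (n : ℕ) (τ c : ℝ) (v w : ℕ → ℝ) (j : ℕ) : ℕ → ℕ :=
  heads τ c (rv n v) (rw n w) (hIdx n (rv n v) (-(v j)))

/-- The sequence of left cluster heads for the vertex `y = v_j`. -/
noncomputable def leftHeads (n : ℕ) (τ c : ℝ) (v w : ℕ → ℝ) (j : ℕ) : ℕ → ℕ :=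
  heads τ c v w (hIdx n v (v j))

/-- The (original-coordinates) index of the head of the right cluster for `y = v_j`
containing vertex `i`. -/
noncomputable def rightClusterHeadOf (n : ℕ) (τ c : ℝ) (v w : ℕ → ℝ) (j i : ℕ) : ℕ :=
  n + 1 - clusterHeadOf τ c (rv n v) (rw n w) (hIdx n (rv n v) (-(v j))) (n + 1 - i)

/-- The weight of the right cluster for `y = v_j` containing vertex `i`. -/
noncomputable def rightClusterWeightOf (n : ℕ) (τ c : ℝ) (v w : ℕ → ℝ) (j i : ℕ) : ℝ :=
  clusterWeightOf τ c (rv n v) (rw n w) (hIdx n (rv n v) (-(v j))) (n + 1 - i)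

/-- `ω` is a critical weight for `v_i` with respect to the vertex `y = v_j`
(left-pseudo-bipartite case): `ω ∈ {w_i^−, w_i^+}` or the right-cluster partition for `y`
under `s(i, ·)` is not constant on any neighborhood of `ω` in `[w_i^−, w_i^+]`. -/
def criticalWeightL (n : ℕ) (τ c : ℝ) (v wm wp : ℕ → ℝ) (j i : ℕ) (ω : ℝ) : Prop :=
  ω ∈ Set.Icc (wm i) (wp i) ∧
    (ω = wm i ∨ ω = wp i ∨
      ¬ ∃ ε > (0 : ℝ), ∀ w ∈ Set.Icc (wm i) (wp i), |w - ω| < ε →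
        rightHeads n τ c v (pseudoBipL wm wp i w) j =
          rightHeads n τ c v (pseudoBipL wm wp i ω) j)

/-- `ω` is a critical weight for `v_i` with respect to the vertex `y = v_j`
(right-pseudo-bipartite case, using the left-cluster partition for `y`). -/
def criticalWeightR (n : ℕ) (τ c : ℝ) (v wm wp : ℕ → ℝ) (j i : ℕ) (ω : ℝ) : Prop :=
  ω ∈ Set.Icc (wm i) (wp i) ∧
    (ω = wm i ∨ ω = wp i ∨
      ¬ ∃ ε > (0 : ℝ), ∀ w ∈ Set.Icc (wm i) (wp i), |w - ω| < ε →
        leftHeads n τ c v (pseudoBipR wm wp i w) j =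
          leftHeads n τ c v (pseudoBipR wm wp i ω) j)

/-- `Q`: the number of right clusters for `y = v_j` under weights `w` that lie entirely
to the right of the right cluster containing `v_i` (counted via reflected cluster heads). -/
noncomputable def Qnum (n : ℕ) (τ c : ℝ) (v w : ℕ → ℝ) (j i : ℕ) : ℕ :=
  (((Finset.range (n + 1)).image (rightHeads n τ c v w j)).filter
      (fun r => 1 ≤ r ∧
        r < clusterHeadOf τ c (rv n v) (rw n w) (hIdx n (rv n v) (-(v j))) (n + 1 - i))).card

end DPN

open DPN

namespace DPN

/-- The cumulative weight of the vertices `1, …, k`. -/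
noncomputable def cumWeight (w : ℕ → ℝ) (k : ℕ) : ℝ := ∑ l ∈ Finset.Ioc 0 k, w l

/-- The arrival time at `x` of the unit of flow that has weight `u` behind it, when the
vertices `1, …, h` evacuate to the right. -/
noncomputable def arrival (τ c : ℝ) (v w : ℕ → ℝ) (h : ℕ) (x u : ℝ) : ℝ :=
  sSup ((fun i => τ * (x - v i) + (cumWeight w i - u) / c) ''
    {i | 1 ≤ i ∧ i ≤ h ∧ u ≤ cumWeight w i})

section CumWeight

variable {w : ℕ → ℝ}

lemma cumWeight_zero : cumWeight w 0 = 0 := by simp [cumWeight]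

lemma sum_Ioc_eq_cumWeight_sub {a b : ℕ} (hab : a ≤ b) :
    ∑ l ∈ Finset.Ioc a b, w l = cumWeight w b - cumWeight w a := by
  have := Finset.sum_Ioc_consecutive w (Nat.zero_le a) hab
  unfold cumWeight
  linarith

lemma cumWeight_mono {h : ℕ} (hw : ∀ i, 1 ≤ i → i ≤ h → 0 ≤ w i) {a b : ℕ}
    (hab : a ≤ b) (hb : b ≤ h) : cumWeight w a ≤ cumWeight w b := by
  have h1 := sum_Ioc_eq_cumWeight_sub (w := w) hab
  have h2 : 0 ≤ ∑ l ∈ Finset.Ioc a b, w l := Finset.sum_nonneg fun i hi => by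
    rw [Finset.mem_Ioc] at hi
    exact hw i (by omega) (by omega)
  linarith

end CumWeight

section Heads

variable {τ c : ℝ} {v w : ℕ → ℝ} {h r : ℕ}

lemma nextHead_eq_of_le (hr : h ≤ r) : nextHead τ c v w h r = h := by
  simp only [nextHead, Finset.Ioc_eq_empty_of_le hr, Finset.filter_empty, Finset.max_empty]
  rfl

lemma nextHead_spec (hr : r < h) :
    r < nextHead τ c v w h r ∧ nextHead τ c v w h r ≤ h ∧
      ∀ i ∈ Finset.Ioc r h, score τ c v w h r i ≤ score τ c v w h r (nextHead τ c v w h r) := by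
  obtain ⟨k, hk, hmax⟩ := Finset.exists_max_image (Finset.Ioc r h) (score τ c v w h r)
    ⟨h, Finset.mem_Ioc.2 ⟨hr, le_rfl⟩⟩
  obtain ⟨m, hm⟩ := Finset.max_of_mem (Finset.mem_filter (p := fun k =>
    ∀ i ∈ Finset.Ioc r h, score τ c v w h r i ≤ score τ c v w h r k).2 ⟨hk, hmax⟩)
  have hnext : nextHead τ c v w h r = m := by
    unfold nextHead
    rw [hm]
    rfl
  have hmem := Finset.mem_of_max hm
  rw [Finset.mem_filter, Finset.mem_Ioc] at hmem
  rw [hnext]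
  exact ⟨hmem.1.1, hmem.1.2, hmem.2⟩

lemma nextHead_le : nextHead τ c v w h r ≤ h := by
  rcases lt_or_ge r h with hr | hr
  · exact (nextHead_spec hr).2.1
  · exact (nextHead_eq_of_le hr).le

lemma heads_le (m : ℕ) : heads τ c v w h m ≤ h := by
  cases m with
  | zero => exact Nat.zero_le h
  | succ m => exact nextHead_le

lemma heads_le_succ (m : ℕ) : heads τ c v w h m ≤ heads τ c v w h (m + 1) := by
  rcases lt_or_ge (heads τ c v w h m) h with hr | hr
  · exact (nextHead_spec hr).1.le
  · exact (heads_le m).trans (nextHead_eq_of_le hr).ge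

lemma min_le_heads (m : ℕ) : min m h ≤ heads τ c v w h m := by
  induction m with
  | zero => simp
  | succ m ih =>
    rcases lt_or_ge (heads τ c v w h m) h with hr | hr
    · have := (nextHead_spec (τ := τ) (c := c) (v := v) (w := w) hr).1
      change _ ≤ nextHead τ c v w h (heads τ c v w h m)
      omega
    · change _ ≤ nextHead τ c v w h (heads τ c v w h m)
      rw [nextHead_eq_of_le hr]
      omega

lemma heads_eq_of_le {m : ℕ} (hm : h ≤ m) : heads τ c v w h m = h :=
  le_antisymm (heads_le m) ((min_eq_right hm).ge.trans (min_le_heads m))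

lemma heads_congr {w' : ℕ → ℝ} (hw : ∀ i, 1 ≤ i → i ≤ h → w i = w' i) :
    heads τ c v w h = heads τ c v w' h := by
  have hscore : ∀ r, ∀ i ∈ Finset.Ioc r h, score τ c v w h r i = score τ c v w' h r i := by
    intro r i hi
    rw [Finset.mem_Ioc] at hi
    unfold score
    congr 2
    refine Finset.sum_congr rfl fun l hl => ?_
    rw [Finset.mem_Ioc] at hl
    exact hw l (by omega) (by omega)
  funext m
  induction m with
  | zero => rfl
  | succ m ih =>
    simp only [heads, ih]
    unfold nextHead
    congr 2
    refine Finset.filter_congr fun i hi => forall₂_congr fun i' hi' => ?_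
    rw [hscore _ i hi, hscore _ i' hi']

end Heads

lemma phiL_congr {n : ℕ} {τ c : ℝ} {v w w' : ℕ → ℝ} {x : ℝ}
    (hw : ∀ i, 1 ≤ i → i ≤ hIdx n v x → w i = w' i) :
    phiL n τ c v w x = phiL n τ c v w' x := by
  unfold phiL
  rw [heads_congr hw]
  refine Finset.sum_congr rfl fun m _ => ?_
  have hsum : ∑ l ∈ Finset.Ioc (heads τ c v w' (hIdx n v x) m)
      (heads τ c v w' (hIdx n v x) (m + 1)), w l = ∑ l ∈ Finset.Ioc
      (heads τ c v w' (hIdx n v x) m) (heads τ c v w' (hIdx n v x) (m + 1)), w' l := by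
    refine Finset.sum_congr rfl fun l hl => ?_
    rw [Finset.mem_Ioc] at hl
    exact hw l (by omega) (hl.2.trans (heads_le _))
  rw [hsum]

section Arrival

variable {τ c : ℝ} {v w : ℕ → ℝ} {h : ℕ} {x u : ℝ}

lemma finite_arrival :
    ((fun i => τ * (x - v i) + (cumWeight w i - u) / c) ''
      {i | 1 ≤ i ∧ i ≤ h ∧ u ≤ cumWeight w i}).Finite :=
  ((Set.finite_Icc 1 h).subset fun _ hi => ⟨hi.1, hi.2.1⟩).image _

lemma le_arrival {i : ℕ} (hi1 : 1 ≤ i) (hih : i ≤ h) (hu : u ≤ cumWeight w i) :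
    τ * (x - v i) + (cumWeight w i - u) / c ≤ arrival τ c v w h x u :=
  le_csSup finite_arrival.bddAbove ⟨i, ⟨hi1, hih, hu⟩, rfl⟩

lemma exists_arrival_eq (hh : 1 ≤ h) (hu : u ≤ cumWeight w h) :
    ∃ i, 1 ≤ i ∧ i ≤ h ∧ u ≤ cumWeight w i ∧
      arrival τ c v w h x u = τ * (x - v i) + (cumWeight w i - u) / c := by
  obtain ⟨i, hi, he⟩ := Set.Nonempty.csSup_mem
    (Set.Nonempty.image (fun i => τ * (x - v i) + (cumWeight w i - u) / c)
      (⟨h, hh, le_rfl, hu⟩ : {i | 1 ≤ i ∧ i ≤ h ∧ u ≤ cumWeight w i}.Nonempty)) finite_arrival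
  exact ⟨i, hi.1, hi.2.1, hi.2.2, he.symm⟩

lemma antitoneOn_arrival (hc : 0 < c) :
    AntitoneOn (arrival τ c v w h x) (Set.Icc 0 (cumWeight w h)) := by
  intro a ha b hb hab
  rcases Nat.eq_zero_or_pos h with rfl | hh
  · rw [cumWeight_zero] at ha hb
    have : a = b := by linarith [ha.1, ha.2, hb.1, hb.2]
    rw [this]
  · obtain ⟨i, hi1, hih, hbi, he⟩ := exists_arrival_eq (τ := τ) (c := c) (v := v) (x := x) hh hb.2
    rw [he]
    refine le_trans ?_ (le_arrival hi1 hih (hab.trans hbi))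
    gcongr

lemma intervalIntegrable_arrival (hc : 0 < c) {a b : ℝ} (ha : 0 ≤ a)
    (hab : a ≤ b) (hb : b ≤ cumWeight w h) :
    IntervalIntegrable (arrival τ c v w h x) MeasureTheory.volume a b := by
  refine ((antitoneOn_arrival hc).mono ?_).intervalIntegrable
  rw [Set.uIcc_of_le hab]
  exact Set.Icc_subset_Icc ha hb

lemma arrival_eq_of_cluster (hw : ∀ i, 1 ≤ i → i ≤ h → 0 ≤ w i) {r : ℕ} (hr : r < h)
    (hu : u ∈ Set.Ioc (cumWeight w r) (cumWeight w (nextHead τ c v w h r))) :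
    arrival τ c v w h x u = τ * (x - v (nextHead τ c v w h r)) +
      (cumWeight w (nextHead τ c v w h r) - u) / c := by
  obtain ⟨h1, h2, h3⟩ := nextHead_spec (τ := τ) (c := c) (v := v) (w := w) hr
  refine le_antisymm ?_ (le_arrival (by omega) h2 hu.2)
  obtain ⟨i, -, hih, hui, he⟩ := exists_arrival_eq (τ := τ) (c := c) (v := v) (x := x)
    (by omega : 1 ≤ h) (hu.2.trans (cumWeight_mono hw h2 le_rfl))
  have hri : r < i := by
    by_contra! hcon
    have := cumWeight_mono hw hcon hr.le
    linarith [hu.1]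
  have hs := h3 i (Finset.mem_Ioc.2 ⟨hri, hih⟩)
  unfold score at hs
  rw [sum_Ioc_eq_cumWeight_sub hri.le, sum_Ioc_eq_cumWeight_sub h1.le] at hs
  rw [he]
  simp only [sub_div] at hs ⊢
  linarith

end Arrival

lemma integral_affine_div {a b c d : ℝ} :
    ∫ u in a..b, (d + (b - u) / c) = (b - a) * d + (b - a) ^ 2 / (2 * c) := by
  have h1 : IntervalIntegrable (fun _ : ℝ => d) MeasureTheory.volume a b := by simp
  have h2 : IntervalIntegrable (fun u : ℝ => (b - u) / c) MeasureTheory.volume a b :=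
    Continuous.intervalIntegrable (by fun_prop) _ _
  rw [intervalIntegral.integral_add h1 h2, intervalIntegral.integral_div,
    intervalIntegral.integral_comp_sub_left (fun u => u) b]
  simp
  ring

lemma hIdx_le {n : ℕ} {v : ℕ → ℝ} {x : ℝ} : hIdx n v x ≤ n := by
  simpa [hIdx] using Finset.card_filter_le (Finset.Icc 1 n) (fun i => v i < x)

/-- The total left evacuation time is the integral of the individual arrival times. -/
lemma phiL_eq_integral {n : ℕ} {τ c : ℝ} {v w : ℕ → ℝ} {x : ℝ} (hc : 0 < c)
    (hw : ∀ i, 1 ≤ i → i ≤ hIdx n v x → 0 ≤ w i) :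
    phiL n τ c v w x =
      ∫ u in (0 : ℝ)..cumWeight w (hIdx n v x), arrival τ c v w (hIdx n v x) x u := by
  have hn : hIdx n v x ≤ n := hIdx_le
  unfold phiL
  generalize hIdx n v x = h at *
  have hcum : ∀ m, cumWeight w (heads τ c v w h m) ≤ cumWeight w (heads τ c v w h (m + 1)) :=
    fun m => cumWeight_mono hw (heads_le_succ m) (heads_le _)
  have hint : ∀ m < n, IntervalIntegrable (arrival τ c v w h x) MeasureTheory.volume
      (cumWeight w (heads τ c v w h m)) (cumWeight w (heads τ c v w h (m + 1))) := fun m _ =>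
    intervalIntegrable_arrival hc
      (cumWeight_zero.ge.trans (cumWeight_mono hw (Nat.zero_le _) (heads_le _))) (hcum m)
      (cumWeight_mono hw (heads_le _) le_rfl)
  have hsum := intervalIntegral.sum_integral_adjacent_intervals hint
  rw [heads_eq_of_le hn] at hsum
  simp only [heads, cumWeight_zero] at hsum
  rw [← hsum]
  refine Finset.sum_congr rfl fun m _ => ?_
  rw [sum_Ioc_eq_cumWeight_sub (heads_le_succ m)]
  rcases lt_or_ge (heads τ c v w h m) h with hr | hr
  · refine Eq.trans integral_affine_div.symm ?_
    refine (intervalIntegral.integral_congr_Ioo_of_le (hcum m) fun u hu => ?_).symm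
    exact arrival_eq_of_cluster hw hr (Set.Ioo_subset_Ioc_self hu)
  · have h1 : heads τ c v w h (m + 1) = h := nextHead_eq_of_le hr
    have h2 : heads τ c v w h m = h := le_antisymm (heads_le m) hr
    change _ = ∫ u in cumWeight w (heads τ c v w h m)..cumWeight w (heads τ c v w h (m + 1)),
      arrival τ c v w h x u
    simp [h1, h2]

/-- Raising the weights behind `y` (the vertices `1, …, j`) does not decrease the difference
between the integrated arrival times at `x` and at `y`. -/
lemma integral_arrival_sub_mono {τ c : ℝ} {v w w' : ℕ → ℝ} {h j : ℕ} {x y : ℝ}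
    (hτ : 0 < τ) (hc : 0 < c) (hj : 1 ≤ j) (hjh : j ≤ h) (hyx : y ≤ x)
    (hv : ∀ i, 1 ≤ i → i ≤ h → v i ≤ x)
    (hw : ∀ i, 1 ≤ i → i ≤ h → 0 ≤ w i)
    (hww' : ∀ i, 1 ≤ i → i ≤ j → w i ≤ w' i)
    (heq : ∀ i, j < i → i ≤ h → w i = w' i) :
    (∫ u in (0 : ℝ)..cumWeight w h, arrival τ c v w h x u) -
        ∫ u in (0 : ℝ)..cumWeight w (j - 1), arrival τ c v w (j - 1) y u ≤
      (∫ u in (0 : ℝ)..cumWeight w' h, arrival τ c v w' h x u) -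
        ∫ u in (0 : ℝ)..cumWeight w' (j - 1), arrival τ c v w' (j - 1) y u := by
  have hw' : ∀ i, 1 ≤ i → i ≤ h → 0 ≤ w' i := fun i h1 h2 => by
    rcases le_or_gt i j with hij | hij
    · exact (hw i h1 h2).trans (hww' i h1 hij)
    · exact (hw i h1 h2).trans (heq i hij h2).le
  have hinc : ∀ a b, a ≤ b → b ≤ j →
      cumWeight w b - cumWeight w a ≤ cumWeight w' b - cumWeight w' a := fun a b hab hb => by
    rw [← sum_Ioc_eq_cumWeight_sub hab, ← sum_Ioc_eq_cumWeight_sub hab]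
    refine Finset.sum_le_sum fun i hi => ?_
    rw [Finset.mem_Ioc] at hi
    exact hww' i (by omega) (by omega)
  have hinc_eq : ∀ b, j ≤ b → b ≤ h →
      cumWeight w b - cumWeight w j = cumWeight w' b - cumWeight w' j := fun b hab hb => by
    rw [← sum_Ioc_eq_cumWeight_sub hab, ← sum_Ioc_eq_cumWeight_sub hab]
    refine Finset.sum_congr rfl fun i hi => ?_
    rw [Finset.mem_Ioc] at hi
    exact heq i (by omega) (by omega)
  have ha0 : 0 ≤ cumWeight w (j - 1) :=
    cumWeight_zero.ge.trans (cumWeight_mono hw (Nat.zero_le _) (by omega))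
  have ha0' : 0 ≤ cumWeight w' (j - 1) :=
    cumWeight_zero.ge.trans (cumWeight_mono hw' (Nat.zero_le _) (by omega))
  have hah : cumWeight w (j - 1) ≤ cumWeight w h := cumWeight_mono hw (by omega) le_rfl
  have hah' : cumWeight w' (j - 1) ≤ cumWeight w' h := cumWeight_mono hw' (by omega) le_rfl
  obtain ⟨δ₀, hδ₀⟩ : ∃ δ₀, cumWeight w' (j - 1) = cumWeight w (j - 1) + δ₀ :=
    ⟨cumWeight w' (j - 1) - cumWeight w (j - 1), by ring⟩
  obtain ⟨δ, hδ⟩ : ∃ δ, cumWeight w' j = cumWeight w j + δ :=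
    ⟨cumWeight w' j - cumWeight w j, by ring⟩
  have hδh : cumWeight w' h = cumWeight w h + δ := by
    linarith [hinc_eq h hjh le_rfl]
  have hδ₀0 : 0 ≤ δ₀ := by
    have := hinc 0 (j - 1) (by omega) (by omega)
    simp only [cumWeight_zero] at this
    linarith
  have hδδ₀ : δ₀ ≤ δ := by linarith [hinc (j - 1) j (by omega) le_rfl]
  have hnonneg : ∀ u ≤ cumWeight w' h, 0 ≤ arrival τ c v w' h x u := fun u hu =>
    le_trans (add_nonneg (mul_nonneg hτ.le (sub_nonneg.2 (hv h (hj.trans hjh) le_rfl)))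
      (div_nonneg (sub_nonneg.2 hu) hc.le)) (le_arrival (hj.trans hjh) le_rfl hu)
  have hIx : ∀ a b, 0 ≤ a → a ≤ b → b ≤ cumWeight w h →
      IntervalIntegrable (arrival τ c v w h x) MeasureTheory.volume a b :=
    fun _ _ => intervalIntegrable_arrival hc
  have hIx' : ∀ a b, 0 ≤ a → a ≤ b → b ≤ cumWeight w' h →
      IntervalIntegrable (arrival τ c v w' h x) MeasureTheory.volume a b :=
    fun _ _ => intervalIntegrable_arrival hc
  have hIy : ∀ a b, 0 ≤ a → a ≤ b → b ≤ cumWeight w (j - 1) →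
      IntervalIntegrable (arrival τ c v w (j - 1) y) MeasureTheory.volume a b :=
    fun _ _ => intervalIntegrable_arrival hc
  have hIy' : ∀ a b, 0 ≤ a → a ≤ b → b ≤ cumWeight w' (j - 1) →
      IntervalIntegrable (arrival τ c v w' (j - 1) y) MeasureTheory.volume a b :=
    fun _ _ => intervalIntegrable_arrival hc
  -- the delay between `y` and `x` is at least the travel time
  have hdelay : ∀ u, 0 < u → u ≤ cumWeight w' (j - 1) →
      arrival τ c v w' (j - 1) y u + τ * (x - y) ≤ arrival τ c v w' h x u := fun u hu0 hu => by
    have hj1 : 1 ≤ j - 1 := by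
      by_contra! hcon
      rw [show j - 1 = 0 by omega, cumWeight_zero] at hu
      linarith
    obtain ⟨i, hi1, hih, hui, he⟩ := exists_arrival_eq (τ := τ) (c := c) (v := v) (x := y) hj1 hu
    have := le_arrival (τ := τ) (c := c) (v := v) (x := x) hi1 (by omega : i ≤ h) hui
    rw [he]
    linarith
  have hbehind : ∀ u ∈ Set.Ioo 0 (cumWeight w (j - 1)),
      arrival τ c v w h x u - arrival τ c v w (j - 1) y u ≤
        arrival τ c v w' h x (u + δ₀) - arrival τ c v w' (j - 1) y (u + δ₀) := fun u hu => by
    have hj1 : 1 ≤ j - 1 := by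
      by_contra! hcon
      rw [show j - 1 = 0 by omega, cumWeight_zero] at hu
      linarith [hu.1, hu.2]
    have hu' : u + δ₀ ≤ cumWeight w' (j - 1) := by linarith [hu.2]
    have hd := hdelay (u + δ₀) (by linarith [hu.1]) hu'
    obtain ⟨i, hi1, hih, hui, he⟩ := exists_arrival_eq (τ := τ) (c := c) (v := v) (x := x)
      (hj.trans hjh) (hu.2.le.trans hah)
    rcases lt_or_ge i j with hij | hij
    · have := le_arrival (τ := τ) (c := c) (v := v) (x := y) hi1 (by omega : i ≤ j - 1) hui
      linarith
    · have hWi : cumWeight w' i = cumWeight w i + δ := by linarith [hinc_eq i hij hih]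
      have h1 := le_arrival (τ := τ) (c := c) (v := v) (x := x) hi1 hih
        (by linarith : u + δ₀ ≤ cumWeight w' i)
      have h2 : (cumWeight w i - u) / c ≤ (cumWeight w' i - (u + δ₀)) / c := by
        gcongr ?_ / c
        linarith
      obtain ⟨k, hk1, hkj, huk, hek⟩ := exists_arrival_eq (τ := τ) (c := c) (v := v) (x := y)
        hj1 hu'
      have hWk := hinc k (j - 1) hkj (by omega)
      have h3 := le_arrival (τ := τ) (c := c) (v := v) (x := y) hk1 hkj
        (by linarith : u ≤ cumWeight w k)
      have h4 : (cumWeight w' k - (u + δ₀)) / c ≤ (cumWeight w k - u) / c := by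
        gcongr ?_ / c
        linarith
      linarith
  have hahead : ∀ u ∈ Set.Ioo (cumWeight w (j - 1)) (cumWeight w h),
      arrival τ c v w h x u ≤ arrival τ c v w' h x (u + δ) := fun u hu => by
    obtain ⟨i, hi1, hih, hui, he⟩ := exists_arrival_eq (τ := τ) (c := c) (v := v) (x := x)
      (hj.trans hjh) hu.2.le
    have hij : j ≤ i := by
      by_contra! hcon
      have := cumWeight_mono hw (by omega : i ≤ j - 1) (by omega)
      linarith [hu.1]
    have hWi : cumWeight w' i = cumWeight w i + δ := by linarith [hinc_eq i hij hih]
    have h1 := le_arrival (τ := τ) (c := c) (v := v) (x := x) hi1 hih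
      (by linarith : u + δ ≤ cumWeight w' i)
    rw [he]
    refine le_trans (le_of_eq ?_) h1
    rw [hWi]
    ring
  have hI₁ : (∫ u in (0 : ℝ)..cumWeight w (j - 1),
        (arrival τ c v w h x u - arrival τ c v w (j - 1) y u)) ≤
      ∫ u in (0 : ℝ)..cumWeight w' (j - 1),
        (arrival τ c v w' h x u - arrival τ c v w' (j - 1) y u) := by
    have hi₁ := (hIx' 0 δ₀ le_rfl hδ₀0 (by linarith)).sub (hIy' 0 δ₀ le_rfl hδ₀0 (by linarith))
    have hi₂ := (hIx' δ₀ (cumWeight w' (j - 1)) hδ₀0 (by linarith) hah').sub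
      (hIy' δ₀ (cumWeight w' (j - 1)) hδ₀0 (by linarith) le_rfl)
    have hpos : 0 ≤ ∫ u in (0 : ℝ)..δ₀,
        (arrival τ c v w' h x u - arrival τ c v w' (j - 1) y u) := by
      rw [intervalIntegral.integral_of_le hδ₀0]
      refine MeasureTheory.setIntegral_nonneg measurableSet_Ioc fun u hu => ?_
      have := hdelay u hu.1 (by linarith [hu.2])
      have := mul_nonneg hτ.le (sub_nonneg.2 hyx)
      linarith
    rw [← intervalIntegral.integral_add_adjacent_intervals hi₁ hi₂]
    have hshift := intervalIntegral.integral_comp_add_right (a := 0) (b := cumWeight w (j - 1))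
      (fun u => arrival τ c v w' h x u - arrival τ c v w' (j - 1) y u) δ₀
    rw [zero_add, ← hδ₀] at hshift
    have hmono := intervalIntegral.integral_mono_on_of_le_Ioo ha0
      ((hIx 0 _ le_rfl ha0 hah).sub (hIy 0 _ le_rfl ha0 le_rfl))
      (by simpa [hδ₀] using hi₂.comp_add_right δ₀) hbehind
    linarith
  have hI₂ : (∫ u in cumWeight w (j - 1)..cumWeight w h, arrival τ c v w h x u) ≤
      ∫ u in cumWeight w' (j - 1)..cumWeight w' h, arrival τ c v w' h x u := by
    have hi₁ := hIx' (cumWeight w' (j - 1)) (cumWeight w (j - 1) + δ) ha0' (by linarith)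
      (by linarith)
    have hi₂ := hIx' (cumWeight w (j - 1) + δ) (cumWeight w' h) (by linarith) (by linarith) le_rfl
    have hpos : 0 ≤ ∫ u in cumWeight w' (j - 1)..(cumWeight w (j - 1) + δ),
        arrival τ c v w' h x u :=
      intervalIntegral.integral_nonneg (by linarith) fun u hu => hnonneg u (by linarith [hu.2])
    rw [← intervalIntegral.integral_add_adjacent_intervals hi₁ hi₂]
    have hshift := intervalIntegral.integral_comp_add_right (a := cumWeight w (j - 1))
      (b := cumWeight w h) (fun u => arrival τ c v w' h x u) δ
    rw [← hδh] at hshift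
    have hmono := intervalIntegral.integral_mono_on_of_le_Ioo hah (hIx _ _ ha0 hah le_rfl)
      (by simpa [hδh] using hi₂.comp_add_right δ) hahead
    linarith
  rw [intervalIntegral.integral_sub (hIx 0 _ le_rfl ha0 hah) (hIy 0 _ le_rfl ha0 le_rfl),
    intervalIntegral.integral_sub (hIx' 0 _ le_rfl ha0' hah') (hIy' 0 _ le_rfl ha0' le_rfl)] at hI₁
  rw [← intervalIntegral.integral_add_adjacent_intervals (hIx 0 _ le_rfl ha0 hah)
      (hIx _ _ ha0 hah le_rfl),
    ← intervalIntegral.integral_add_adjacent_intervals (hIx' 0 _ le_rfl ha0' hah')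
      (hIx' _ _ ha0' hah' le_rfl)]
  linarith

section HIdx

variable {n : ℕ} {v : ℕ → ℝ} {x : ℝ}

lemma strictMonoOn_of_lt_succ (hv : ∀ i, 1 ≤ i → i < n → v i < v (i + 1)) :
    StrictMonoOn v (Set.Icc 1 n) := by
  intro a ha b hb hab
  obtain ⟨ha1, -⟩ := ha
  obtain ⟨-, hbn⟩ := hb
  induction b, hab using Nat.le_induction with
  | base => exact hv a ha1 (by omega)
  | succ b hab ih => exact (ih (by omega)).trans (hv b (by omega) (by omega))

lemma hIdx_vertex (hv : StrictMonoOn v (Set.Icc 1 n)) {j : ℕ} (hj1 : 1 ≤ j) (hjn : j ≤ n) :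
    hIdx n v (v j) = j - 1 := by
  have : (Finset.Icc 1 n).filter (fun i => v i < v j) = Finset.Icc 1 (j - 1) := by
    ext i
    simp only [Finset.mem_filter, Finset.mem_Icc]
    constructor
    · rintro ⟨hi, hlt⟩
      have := (hv.lt_iff_lt hi ⟨hj1, hjn⟩).1 hlt
      omega
    · intro hi
      exact ⟨by omega, hv ⟨hi.1, by omega⟩ ⟨hj1, hjn⟩ (by omega)⟩
  simp [hIdx, this]

lemma le_hIdx (hv : StrictMonoOn v (Set.Icc 1 n)) {j : ℕ} (hj1 : 1 ≤ j) (hjn : j ≤ n)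
    (hjx : v j < x) : j ≤ hIdx n v x := by
  have : Finset.Icc 1 j ⊆ (Finset.Icc 1 n).filter (fun i => v i < x) := fun i hi => by
    rw [Finset.mem_Icc] at hi
    rw [Finset.mem_filter, Finset.mem_Icc]
    exact ⟨by omega, ((hv.le_iff_le ⟨hi.1, by omega⟩ ⟨hj1, hjn⟩).2 hi.2).trans_lt hjx⟩
  simpa [hIdx] using Finset.card_le_card this

lemma lt_of_le_hIdx (hv : StrictMonoOn v (Set.Icc 1 n)) {i : ℕ} (hi1 : 1 ≤ i)
    (hi : i ≤ hIdx n v x) : v i < x := by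
  by_contra! hcon
  have hin : i ≤ n := hi.trans hIdx_le
  have : (Finset.Icc 1 n).filter (fun k => v k < x) ⊆ Finset.Icc 1 (i - 1) := fun k hk => by
    rw [Finset.mem_filter, Finset.mem_Icc] at hk
    have := (hv.lt_iff_lt hk.1 ⟨hi1, hin⟩).1 (hk.2.trans_le hcon)
    rw [Finset.mem_Icc]
    omega
  have hcard : hIdx n v x ≤ i - 1 := by simpa [hIdx] using Finset.card_le_card this
  omega

lemma hIdx_rv_le (hv : StrictMonoOn v (Set.Icc 1 n)) {j : ℕ} (hj1 : 1 ≤ j) (hjn : j ≤ n)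
    (hjx : v j ≤ x) : hIdx n (rv n v) (-x) ≤ n - j := by
  have : (Finset.Icc 1 n).filter (fun k => rv n v k < -x) ⊆ Finset.Icc 1 (n - j) := fun k hk => by
    rw [Finset.mem_filter, Finset.mem_Icc] at hk
    obtain ⟨hk, hlt⟩ := hk
    have hlt' : v j < v (n + 1 - k) := hjx.trans_lt (neg_lt_neg_iff.1 hlt)
    have := (hv.lt_iff_lt ⟨hj1, hjn⟩ ⟨by omega, by omega⟩).1 hlt'
    rw [Finset.mem_Icc]
    omega
  simpa [hIdx] using Finset.card_le_card this

end HIdx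

lemma phiR_congr {n : ℕ} {τ c : ℝ} {v w w' : ℕ → ℝ} (hv : StrictMonoOn v (Set.Icc 1 n)) {j : ℕ}
    (hj1 : 1 ≤ j) (hjn : j ≤ n) {x : ℝ} (hjx : v j ≤ x)
    (hw : ∀ i, j < i → i ≤ n → w i = w' i) :
    phiR n τ c v w x = phiR n τ c v w' x :=
  phiL_congr fun i hi1 hi => by
    have := hi.trans (hIdx_rv_le hv hj1 hjn hjx)
    exact hw _ (by omega) (by omega)

/-- Raising the weights of `v_1, …, v_j` does not decrease the gap between a point to the right
of `v_j` and `v_j`. -/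
lemma gap_mono_of_le {n : ℕ} {τ c : ℝ} (hτ : 0 < τ) (hc : 0 < c) {v w w' : ℕ → ℝ}
    (hv : StrictMonoOn v (Set.Icc 1 n)) {j : ℕ} (hj1 : 1 ≤ j) (hjn : j ≤ n) {x : ℝ}
    (hjx : v j < x) (hw : ∀ i, 1 ≤ i → i ≤ n → 0 ≤ w i)
    (hww' : ∀ i, 1 ≤ i → i ≤ j → w i ≤ w' i) (heq : ∀ i, j < i → i ≤ n → w i = w' i) :
    gap n τ c v w x (v j) ≤ gap n τ c v w' x (v j) := by
  have hw' : ∀ i, 1 ≤ i → i ≤ n → 0 ≤ w' i := fun i h1 h2 => by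
    rcases le_or_gt i j with hij | hij
    · exact (hw i h1 h2).trans (hww' i h1 hij)
    · exact (hw i h1 h2).trans (heq i hij h2).le
  have hn : hIdx n v x ≤ n := hIdx_le
  have hL := integral_arrival_sub_mono (v := v) hτ hc hj1 (le_hIdx hv hj1 hjn hjx) hjx.le
    (fun i h1 h2 => (lt_of_le_hIdx hv h1 h2).le) (fun i h1 h2 => hw i h1 (h2.trans hn)) hww'
    (fun i h1 h2 => heq i h1 (h2.trans hn))
  have hpx := phiL_eq_integral (τ := τ) (v := v) (x := x) hc
    (fun i h1 h2 => hw i h1 (h2.trans hIdx_le))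
  have hpx' := phiL_eq_integral (τ := τ) (v := v) (x := x) hc
    (fun i h1 h2 => hw' i h1 (h2.trans hIdx_le))
  have hpy := phiL_eq_integral (τ := τ) (v := v) (x := v j) hc
    (fun i h1 h2 => hw i h1 (h2.trans hIdx_le))
  have hpy' := phiL_eq_integral (τ := τ) (v := v) (x := v j) hc
    (fun i h1 h2 => hw' i h1 (h2.trans hIdx_le))
  rw [hIdx_vertex hv hj1 hjn] at hpy hpy'
  unfold gap phi
  rw [phiR_congr hv hj1 hjn hjx.le heq, phiR_congr hv hj1 hjn le_rfl heq, hpx, hpx', hpy, hpy']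
  linarith

end DPN

theorem stmt7 (n : ℕ) (τ c : ℝ) (hτ : 0 < τ) (hc : 0 < c) (v : ℕ → ℝ)
    (hv : ∀ i, 1 ≤ i → i < n → v i < v (i + 1))
    (wm wp : ℕ → ℝ) (hwm : ∀ i, 1 ≤ i → i ≤ n → 0 < wm i)
    (hwmp : ∀ i, 1 ≤ i → i ≤ n → wm i ≤ wp i)
    (j : ℕ) (hj1 : 1 ≤ j) (hjn : j ≤ n)
    (x : ℝ) (hx : x ∈ Set.Icc (v 1) (v n)) (hyx : v j < x) :
    sSup {g | ∃ s ∈ scenarios n wm wp, g = gap n τ c v s x (v j)} =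
        sSup {g | ∃ s ∈ scenarios n wm wp,
          (∀ l, 1 ≤ l → l ≤ n → v l ≤ v j → s l = wp l) ∧
            g = gap n τ c v s x (v j)} ∧
      ((∃ s ∈ scenarios n wm wp, ∀ s' ∈ scenarios n wm wp,
          gap n τ c v s' x (v j) ≤ gap n τ c v s x (v j)) →
        ∃ s ∈ scenarios n wm wp,
          (∀ l, 1 ≤ l → l ≤ n → v l ≤ v j → s l = wp l) ∧
            ∀ s' ∈ scenarios n wm wp,
              gap n τ c v s' x (v j) ≤ gap n τ c v s x (v j)) := by
  have hmono := strictMonoOn_of_lt_succ hv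
  have key : ∀ s ∈ scenarios n wm wp, ∃ s' ∈ scenarios n wm wp,
      (∀ l, 1 ≤ l → l ≤ n → v l ≤ v j → s' l = wp l) ∧
        gap n τ c v s x (v j) ≤ gap n τ c v s' x (v j) := by
    intro s hs
    refine ⟨fun l => if l ≤ j then wp l else s l, fun i h1 h2 => ?_, fun l h1 h2 hl => ?_, ?_⟩
    · dsimp only
      split_ifs
      · exact ⟨hwmp i h1 h2, le_rfl⟩
      · exact hs i h1 h2
    · exact if_pos ((hmono.le_iff_le ⟨h1, h2⟩ ⟨hj1, hjn⟩).1 hl)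
    · refine gap_mono_of_le hτ hc hmono hj1 hjn hyx
        (fun i h1 h2 => (hwm i h1 h2).le.trans (hs i h1 h2).1) (fun i h1 h2 => ?_)
        (fun i h1 h2 => (if_neg h1.not_ge).symm)
      rw [if_pos h2]
      exact (hs i h1 (h2.trans hjn)).2
  constructor
  · apply csSup_eq_csSup_of_forall_exists_le
    · rintro _ ⟨s, hs, rfl⟩
      obtain ⟨s', hs', hp, hle⟩ := key s hs
      exact ⟨_, ⟨s', hs', hp, rfl⟩, hle⟩
    · rintro _ ⟨s, hs, -, rfl⟩
      exact ⟨_, ⟨s, hs, rfl⟩, le_rfl⟩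
  · rintro ⟨s, hs, hmax⟩
    obtain ⟨s', hs', hp, hle⟩ := key s hs
    exact ⟨s', hs', hp, fun t ht => (hmax t ht).trans hle⟩
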